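/- Let G decompose as a finite graph of groups such that each vertex group is finitely generated, undistorted, and has the property that every strongly quasiconvex infinite subgroup of it has finite index, and each edge group is infinite. Then every strongly quasiconvex, torsion-free subgroup H of G of infinite index is a free group. -/

import Mathlib

open Set

namespace Paper

/-- Word metric distance with respect to a (symmetrized) generating set `S`. -/
noncomputable def wordDist {G : Type*} [Group G] (S : Set G) (g h : G) : ℕ :=
  sInf {n | ∃ w : List G, w.length = n ∧ (∀ x ∈ w, x ∈ S ∨ x⁻¹ ∈ S) ∧ g⁻¹ * h = w.prod}

/-- A discrete `(K, C)`-quasi-geodesic in the word metric. -/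
def IsQuasiGeodesic {G : Type*} [Group G] (S : Set G) (K C : ℝ) {n : ℕ}
    (q : Fin (n + 1) → G) : Prop :=
  ∀ i j : Fin (n + 1),
    (wordDist S (q i) (q j) : ℝ) ≤ K * |((i : ℕ) : ℝ) - ((j : ℕ) : ℝ)| + C ∧
      |((i : ℕ) : ℝ) - ((j : ℕ) : ℝ)| / K - C ≤ (wordDist S (q i) (q j) : ℝ)

/-- A subset `H` is strongly quasiconvex (Morse) with respect to the word metric of `S`:
every quasi-geodesic with endpoints in `H` stays uniformly close to `H`. -/
def StronglyQuasiconvex {G : Type*} [Group G] (S : Set G) (H : Set G) : Prop :=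
  ∀ K C : ℝ, 1 ≤ K → 0 ≤ C → ∃ M : ℝ, ∀ (n : ℕ) (q : Fin (n + 1) → G),
    q 0 ∈ H → q (Fin.last n) ∈ H → IsQuasiGeodesic S K C q →
      ∀ i, ∃ h ∈ H, (wordDist S (q i) h : ℝ) ≤ M

/-- The subgroup `H` (with generating data `T`) is undistorted in `G` (with generating data `S`):
the inclusion is a quasi-isometric embedding for the word metrics. -/
def Undistorted {G : Type*} [Group G] (S : Set G) (H : Subgroup G) (T : Set H) : Prop :=
  ∃ K C : ℝ, 1 ≤ K ∧ 0 ≤ C ∧ ∀ a b : H,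
    (wordDist T a b : ℝ) ≤ K * (wordDist S (a : G) (b : G)) + C ∧
      (wordDist S (a : G) (b : G) : ℝ) ≤ K * (wordDist T a b) + C

/-- Quasi-isometry between two groups with chosen generating sets. -/
def QuasiIsometric (G : Type*) [Group G] (S : Set G) (H : Type*) [Group H] (T : Set H) :
    Prop :=
  ∃ (φ : G → H) (K C : ℝ), 1 ≤ K ∧ 0 ≤ C ∧
    (∀ a b : G,
      (wordDist T (φ a) (φ b) : ℝ) ≤ K * (wordDist S a b) + C ∧
        (wordDist S a b : ℝ) ≤ K * (wordDist T (φ a) (φ b)) + C) ∧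
    ∀ h : H, ∃ g : G, (wordDist T (φ g) h : ℝ) ≤ C

/-- A group action on a graph by graph automorphisms. -/
def ActsOnGraph (G : Type*) [Group G] {V : Type*} [MulAction G V] (Γ : SimpleGraph V) :
    Prop :=
  ∀ (g : G) (v w : V), Γ.Adj v w → Γ.Adj (g • v) (g • w)

/-- Relators of the right-angled Coxeter group of a graph. -/
def racgRels {V : Type*} (Γ : SimpleGraph V) : Set (FreeGroup V) :=
  {r | ∃ v : V, r = FreeGroup.of v * FreeGroup.of v} ∪
    {r | ∃ v w : V, Γ.Adj v w ∧ r = (FreeGroup.of v * FreeGroup.of w) ^ 2}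

/-- The right-angled Coxeter group of a simplicial graph. -/
abbrev RACG {V : Type*} (Γ : SimpleGraph V) : Type _ := PresentedGroup (racgRels Γ)

/-- The standard (vertex) generating set of a RACG. -/
def racgGen {V : Type*} (Γ : SimpleGraph V) : Set (RACG Γ) :=
  Set.range fun v : V => (PresentedGroup.of v : RACG Γ)

/-- The special subgroup of a RACG generated by a set of vertices. -/
def specialSubgroup {V : Type*} (Γ : SimpleGraph V) (J : Set V) : Subgroup (RACG Γ) :=
  Subgroup.closure ((fun v : V => (PresentedGroup.of v : RACG Γ)) '' J)

/-- Relators of the right-angled Artin group of a graph. -/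
def raagRels {V : Type*} (Γ : SimpleGraph V) : Set (FreeGroup V) :=
  {r | ∃ v w : V, Γ.Adj v w ∧
    r = FreeGroup.of v * FreeGroup.of w * (FreeGroup.of v)⁻¹ * (FreeGroup.of w)⁻¹}

/-- The right-angled Artin group of a simplicial graph. -/
abbrev RAAG {V : Type*} (Γ : SimpleGraph V) : Type _ := PresentedGroup (raagRels Γ)

/-- The standard (vertex) generating set of a RAAG. -/
def raagGen {V : Type*} (Γ : SimpleGraph V) : Set (RAAG Γ) :=
  Set.range fun v : V => (PresentedGroup.of v : RAAG Γ)

/-- The coned-off Cayley graph of `G` with respect to the generating set `S` and the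
peripheral collection `P`. -/
def conedOffCayley (G : Type*) [Group G] (S : Set G) {ι : Type*} (P : ι → Subgroup G) :
    SimpleGraph (G ⊕ Σ i : ι, G ⧸ P i) :=
  SimpleGraph.fromRel fun x y =>
    match x, y with
    | Sum.inl g, Sum.inl h => g⁻¹ * h ∈ S
    | Sum.inl g, Sum.inr ⟨i, c⟩ => (QuotientGroup.mk g : G ⧸ P i) = c
    | _, _ => False

/-- A connected graph is hyperbolic if its path metric satisfies the four-point condition. -/
def IsHyperbolicGraph {α : Type*} (Γ : SimpleGraph α) : Prop :=
  Γ.Connected ∧ ∃ δ : ℝ, 0 ≤ δ ∧ ∀ x y z w : α,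
    (Γ.dist x y : ℝ) + (Γ.dist z w : ℝ) ≤
      max ((Γ.dist x z : ℝ) + (Γ.dist y w : ℝ)) ((Γ.dist x w : ℝ) + (Γ.dist y z : ℝ)) + δ

/-- A graph is fine if each edge lies in only finitely many circuits of each bounded length. -/
def IsFineGraph {α : Type*} (Γ : SimpleGraph α) : Prop :=
  ∀ (n : ℕ) (v w : α), Γ.Adj v w →
    {p : Γ.Walk v v | p.IsCircuit ∧ p.length ≤ n ∧ s(v, w) ∈ p.edges}.Finite

/-- `G` is hyperbolic relative to the finite collection of subgroups `P`. -/
def RelativelyHyperbolic (G : Type*) [Group G] {ι : Type*} (P : ι → Subgroup G) : Prop :=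
  Finite ι ∧ ∃ S : Finset G, Subgroup.closure (S : Set G) = ⊤ ∧
    IsHyperbolicGraph (conedOffCayley G (S : Set G) P) ∧
    IsFineGraph (conedOffCayley G (S : Set G) P)

/-- There is a path from `x` to `y` of length at most `L` in the Cayley graph of `(G,S)`
avoiding the ball of radius `r` about the identity. -/
def PathAvoiding {G : Type*} [Group G] (S : Set G) (r : ℕ) (x y : G) (L : ℕ) : Prop :=
  ∃ (m : ℕ) (p : Fin (m + 1) → G), p 0 = x ∧ p (Fin.last m) = y ∧ m ≤ L ∧
    (∀ i : Fin m, wordDist S (p i.castSucc) (p i.succ) ≤ 1) ∧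
    ∀ i, r ≤ wordDist S 1 (p i)

/-- The divergence of `(G,S)` is bounded above by (a linear function of) `f`. -/
def DivergenceUpperBound (G : Type*) [Group G] (S : Set G) (f : ℕ → ℕ) : Prop :=
  ∃ A B : ℕ, 0 < A ∧ ∀ (n : ℕ) (x y : G), wordDist S 1 x = n → wordDist S 1 y = n →
    PathAvoiding S (n / 2) x y (A * f n + B)

/-- The divergence of `(G,S)` is bounded below by (a linear function of) `f`. -/
def DivergenceLowerBound (G : Type*) [Group G] (S : Set G) (f : ℕ → ℕ) : Prop :=
  ∃ A B : ℕ, 0 < A ∧ ∀ N : ℕ, ∃ n, N ≤ n ∧ ∃ x y : G,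
    wordDist S 1 x = n ∧ wordDist S 1 y = n ∧
    ∀ L : ℕ, PathAvoiding S (n / 2) x y L → f n ≤ A * L + B

def HasLinearDivergence (G : Type*) [Group G] (S : Set G) : Prop :=
  DivergenceUpperBound G S (fun n => n) ∧ DivergenceLowerBound G S (fun n => n)

def HasQuadraticDivergence (G : Type*) [Group G] (S : Set G) : Prop :=
  DivergenceUpperBound G S (fun n => n ^ 2) ∧ DivergenceLowerBound G S (fun n => n ^ 2)

def HasExponentialDivergence (G : Type*) [Group G] (S : Set G) : Prop :=
  (∃ b : ℕ, 2 ≤ b ∧ DivergenceUpperBound G S (fun n => b ^ n)) ∧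
    DivergenceLowerBound G S (fun n => 2 ^ n)

/-- `c` parametrizes an induced 4-cycle of `Γ`. -/
def IsInducedFourCycle {V : Type*} (Γ : SimpleGraph V) (c : Fin 4 → V) : Prop :=
  Function.Injective c ∧ ∀ i j : Fin 4, Γ.Adj (c i) (c j) ↔ (j = i + 1 ∨ i = j + 1)

/-- `s` is the vertex set of an induced 4-cycle of `Γ`. -/
def IsFourCycleSet {V : Type*} (Γ : SimpleGraph V) (s : Set V) : Prop :=
  ∃ c : Fin 4 → V, IsInducedFourCycle Γ c ∧ Set.range c = s

/-- The four-cycle graph `Γ⁴`: vertices are the induced 4-cycles of `Γ`, adjacent when the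
corresponding 4-cycles share a pair of non-adjacent vertices. -/
def fourCycleGraph {V : Type*} (Γ : SimpleGraph V) :
    SimpleGraph {s : Set V // IsFourCycleSet Γ s} :=
  SimpleGraph.fromRel fun s t =>
    ∃ a b : V, a ≠ b ∧ ¬ Γ.Adj a b ∧ a ∈ s.1 ∩ t.1 ∧ b ∈ s.1 ∩ t.1

/-- `Γ` is CFS: `Γ = Ω * K` with `K` a (possibly empty) clique and `Ω` nonempty such that
`Ω⁴` has a connected component whose support is all of `V(Ω)`. -/
def CFS {V : Type*} (Γ : SimpleGraph V) : Prop :=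
  ∃ Ω K : Set V, Ω ∪ K = Set.univ ∧ Disjoint Ω K ∧ Ω.Nonempty ∧
    (∀ a ∈ K, ∀ b ∈ K, a ≠ b → Γ.Adj a b) ∧
    (∀ a ∈ Ω, ∀ b ∈ K, Γ.Adj a b) ∧
    ∃ s₀ : {s : Set ↥Ω // IsFourCycleSet (Γ.induce Ω) s},
      ∀ v : ↥Ω, ∃ t : {s : Set ↥Ω // IsFourCycleSet (Γ.induce Ω) s},
        (fourCycleGraph (Γ.induce Ω)).Reachable s₀ t ∧ v ∈ t.1

/-- A (topological) planar embedding of the graph `Γ`: vertices go to distinct points of the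
plane, each edge to an arc between the images of its endpoints, arcs meeting only at common
endpoint vertices. -/
structure PlanarEmbedding {V : Type*} (Γ : SimpleGraph V) where
  vmap : V → ℝ × ℝ
  inj : Function.Injective vmap
  emap : Sym2 V → Set (ℝ × ℝ)
  arc : ∀ ⦃u v : V⦄, Γ.Adj u v → ∃ γ : Path (vmap u) (vmap v),
    Function.Injective (⇑γ) ∧ Set.range (⇑γ) = emap s(u, v)
  disjointEdges : ∀ e ∈ Γ.edgeSet, ∀ e' ∈ Γ.edgeSet, e ≠ e' →
    emap e ∩ emap e' ⊆ Set.range vmap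
  vertexOnEdge : ∀ e ∈ Γ.edgeSet, ∀ v : V, vmap v ∈ emap e → v ∈ e

/-- The image in the plane of the full subgraph of `Γ` spanned by the vertex set `W`. -/
def PlanarEmbedding.imageOf {V : Type*} {Γ : SimpleGraph V} (f : PlanarEmbedding Γ)
    (W : Set V) : Set (ℝ × ℝ) :=
  (f.vmap '' W) ∪ ⋃ (e : Sym2 V) (_ : e ∈ Γ.edgeSet) (_ : ∀ x ∈ e, x ∈ W), f.emap e

/-- The 4-cycle `c` strongly separates the subgraph of `Γ` spanned by `W` with respect to the
embedding `f`: the image of the subgraph meets (at least) two distinct connected components of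
the complement of the image of `c`. -/
def StronglySeparatesIn {V : Type*} {Γ : SimpleGraph V} (f : PlanarEmbedding Γ)
    (c : Fin 4 → V) (W : Set V) : Prop :=
  ∃ x y : ℝ × ℝ, x ∈ f.imageOf W ∧ y ∈ f.imageOf W ∧
    x ∉ f.imageOf (Set.range c) ∧ y ∉ f.imageOf (Set.range c) ∧
    y ∉ connectedComponentIn (f.imageOf (Set.range c))ᶜ x

/-- `(W₁, W₂)` is a strong visual decomposition of `Γ` along the induced 4-cycle `c`
with respect to the embedding `f`. -/
def StrongVisualDecomposition {V : Type*} {Γ : SimpleGraph V} (f : PlanarEmbedding Γ)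
    (c : Fin 4 → V) (W₁ W₂ : Set V) : Prop :=
  IsInducedFourCycle Γ c ∧
  W₁ ∪ W₂ = Set.univ ∧ W₁ ∩ W₂ = Set.range c ∧
  (W₁ \ Set.range c).Nonempty ∧ (W₂ \ Set.range c).Nonempty ∧
  (∀ v ∈ W₁ \ Set.range c, ∀ w ∈ W₂ \ Set.range c,
    f.vmap w ∉ connectedComponentIn (f.imageOf (Set.range c))ᶜ (f.vmap v)) ∧
  (∀ u v : V, Γ.Adj u v → (u ∈ W₁ ∧ v ∈ W₁) ∨ (u ∈ W₂ ∧ v ∈ W₂))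

/-- Standing Assumptions: connected, triangle-free, planar, at least five vertices,
no separating vertices or edges. -/
def StandingAssumptions {V : Type*} (Γ : SimpleGraph V) : Prop :=
  Γ.Connected ∧ Γ.CliqueFree 3 ∧ Nonempty (PlanarEmbedding Γ) ∧ 5 ≤ Nat.card V ∧
  (∀ v : V, (Γ.induce ({v}ᶜ : Set V)).Connected) ∧
  (∀ u v : V, Γ.Adj u v → (Γ.induce ({u, v}ᶜ : Set V)).Connected)

/-- `Γ` contains (as a subgraph) a suspension of three distinct points. -/
def ContainsSuspThree {V : Type*} (Γ : SimpleGraph V) : Prop :=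
  ∃ (a : Fin 3 → V) (b : Fin 2 → V), Function.Injective a ∧ Function.Injective b ∧
    (∀ i j, a i ≠ b j) ∧ ∀ i j, Γ.Adj (a i) (b j)

/-- `Γ` is (exactly) the suspension of three distinct points. -/
def IsSuspensionOfThreePoints {V : Type*} (Γ : SimpleGraph V) : Prop :=
  ∃ (a : Fin 3 → V) (b : Fin 2 → V), Function.Injective a ∧ Function.Injective b ∧
    (∀ i j, a i ≠ b j) ∧ Set.range a ∪ Set.range b = Set.univ ∧
    ∀ x y : V, Γ.Adj x y ↔ ((∃ i j, x = a i ∧ y = b j) ∨ (∃ i j, x = b j ∧ y = a i))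

/-- `Γ` is a suspension of a set of distinct (pairwise non-adjacent) vertices. -/
def IsSuspension {V : Type*} (Γ : SimpleGraph V) : Prop :=
  ∃ b₁ b₂ : V, b₁ ≠ b₂ ∧ ¬ Γ.Adj b₁ b₂ ∧
    (∀ v, v ≠ b₁ → v ≠ b₂ → Γ.Adj v b₁ ∧ Γ.Adj v b₂) ∧
    (∀ u v, u ≠ b₁ → u ≠ b₂ → v ≠ b₁ → v ≠ b₂ → ¬ Γ.Adj u v)

/-- `Γ` is a join of two nonempty subgraphs. -/
def IsJoin {V : Type*} (Γ : SimpleGraph V) : Prop :=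
  ∃ A B : Set V, A.Nonempty ∧ B.Nonempty ∧ Disjoint A B ∧ A ∪ B = Set.univ ∧
    ∀ a ∈ A, ∀ b ∈ B, Γ.Adj a b

/-- `Γ` is prime: not a 4-cycle, and some planar embedding has no strongly separating
4-cycle. -/
def IsPrime {V : Type*} (Γ : SimpleGraph V) : Prop :=
  (¬ ∃ c : Fin 4 → V, IsInducedFourCycle Γ c ∧ Set.range c = Set.univ) ∧
  ∃ f : PlanarEmbedding Γ, ∀ c : Fin 4 → V, IsInducedFourCycle Γ c →
    ¬ StronglySeparatesIn f c Set.univ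

/-- The closed half-space model for 3-manifolds with boundary. -/
def HalfSpace3 : Set (Fin 3 → ℝ) := {y | 0 ≤ y 0}

/-- A topological 3-manifold, possibly with boundary. -/
def IsManifold3WithBoundary (M : Type*) [TopologicalSpace M] : Prop :=
  T2Space M ∧ SecondCountableTopology M ∧ ∀ x : M, ∃ U : Set M, IsOpen U ∧ x ∈ U ∧
    ∃ W : Set ↥HalfSpace3, IsOpen W ∧ Nonempty (↥U ≃ₜ ↥W)

/-- A compact 3-manifold foliated by circles (Seifert fibered, by Epstein's theorem). -/
def SeifertLike (M : Type*) [TopologicalSpace M] : Prop :=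
  IsManifold3WithBoundary M ∧ CompactSpace M ∧ Nonempty M ∧
  ∃ (B : Type) (_ : TopologicalSpace B) (p : M → B),
    Continuous p ∧ Function.Surjective p ∧ ∀ b : B, Nonempty (↥(p ⁻¹' {b}) ≃ₜ Circle)

abbrev Torus : Type := Circle × Circle

/-- A (non-geometric) graph manifold: a compact 3-manifold, not itself Seifert fibered,
which is a union of finitely many closed Seifert pieces meeting along disjoint unions of
tori. -/
def IsGraphManifold (M : Type*) [TopologicalSpace M] : Prop :=
  IsManifold3WithBoundary M ∧ CompactSpace M ∧ ¬ SeifertLike M ∧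
  ∃ (n : ℕ) (P : Fin n → Set M),
    (⋃ i, P i) = Set.univ ∧
    (∀ i, IsClosed (P i) ∧ SeifertLike ↥(P i)) ∧
    ∀ i j, i ≠ j → ∃ k : ℕ, Nonempty (↥(P i ∩ P j) ≃ₜ (Fin k × Torus))

/-- A pointed topological space. -/
structure PointedSpace where
  carrier : Type
  top : TopologicalSpace carrier
  pt : carrier

attribute [instance] PointedSpace.top

/-- `G` is virtually the fundamental group of a Seifert fibered 3-manifold. -/
def VirtuallySeifert (G : Type*) [Group G] : Prop :=
  ∃ H : Subgroup G, H.FiniteIndex ∧ ∃ X : PointedSpace,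
    SeifertLike X.carrier ∧ Nonempty (H ≃* FundamentalGroup X.carrier X.pt)

/-- `G` is virtually the fundamental group of a graph manifold. -/
def VirtuallyGraphManifold (G : Type*) [Group G] : Prop :=
  ∃ H : Subgroup G, H.FiniteIndex ∧ ∃ X : PointedSpace,
    IsGraphManifold X.carrier ∧ Nonempty (H ≃* FundamentalGroup X.carrier X.pt)

/-- A vertex-colored graph. -/
structure ColoredGraph (C : Type*) where
  V : Type
  graph : SimpleGraph V
  color : V → C

/-- A weak covering of colored graphs: a color-preserving graph homomorphism with the
edge-lifting property. -/
def WeakCovering {C : Type*} (Λ Λ' : ColoredGraph C) (f : Λ.V → Λ'.V) : Prop :=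
  (∀ v, Λ'.color (f v) = Λ.color v) ∧
  (∀ v w, Λ.graph.Adj v w → Λ'.graph.Adj (f v) (f w)) ∧
  (∀ v w', Λ'.graph.Adj (f v) w' → ∃ w, Λ.graph.Adj v w ∧ f w = w')

/-- Two colored graphs are bisimilar if they weakly cover a common colored graph. -/
def Bisimilar {C : Type*} (Λ₁ Λ₂ : ColoredGraph C) : Prop :=
  ∃ (Λ : ColoredGraph C) (f₁ : Λ₁.V → Λ.V) (f₂ : Λ₂.V → Λ.V),
    WeakCovering Λ₁ Λ f₁ ∧ WeakCovering Λ₂ Λ f₂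

/-- Isomorphism of colored graphs. -/
def ColoredIso {C : Type*} (Λ₁ Λ₂ : ColoredGraph C) : Prop :=
  ∃ e : Λ₁.V ≃ Λ₂.V, (∀ v, Λ₂.color (e v) = Λ₁.color v) ∧
    ∀ v w, Λ₁.graph.Adj v w ↔ Λ₂.graph.Adj (e v) (e w)
/-- A visual decomposition tree of a CFS graph `Γ` satisfying the Standing Assumptions:
a finite tree whose vertices carry suspension subgraphs `Γv t = susp(Av t)` (with the two
suspension points `pole1 t`, `pole2 t`), glued along induced 4-cycles. -/
structure VisualDecompTree (V : Type*) (Γ : SimpleGraph V) where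
  T : Type
  finite : Finite T
  tree : SimpleGraph T
  isTree : tree.IsTree
  Γv : T → Set V
  Av : T → Set V
  pole1 : T → V
  pole2 : T → V
  susp : ∀ t : T,
    pole1 t ≠ pole2 t ∧ ¬ Γ.Adj (pole1 t) (pole2 t) ∧
    Γv t = Av t ∪ {pole1 t, pole2 t} ∧ pole1 t ∉ Av t ∧ pole2 t ∉ Av t ∧
    (∀ a ∈ Av t, Γ.Adj a (pole1 t) ∧ Γ.Adj a (pole2 t)) ∧
    (∀ a ∈ Av t, ∀ b ∈ Av t, ¬ Γ.Adj a b)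
  three : ∀ t : T, 3 ≤ Nat.card (Av t)
  distinct : Function.Injective Γv
  covers : (⋃ t : T, Γv t) = Set.univ
  edges4 : ∀ t₁ t₂ : T, tree.Adj t₁ t₂ →
    Γv t₁ ∩ Γv t₂ = {pole1 t₁, pole2 t₁, pole1 t₂, pole2 t₂} ∧
    IsFourCycleSet Γ (Γv t₁ ∩ Γv t₂)
  nonedges : ∀ t₁ t₂ : T, t₁ ≠ t₂ → ¬ tree.Adj t₁ t₂ →
    ¬ IsFourCycleSet Γ (Γv t₁ ∩ Γv t₂)
  polesIn : ∀ t₁ t₂ : T, tree.Adj t₁ t₂ → pole1 t₁ ∈ Av t₂ ∧ pole2 t₁ ∈ Av t₂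

/-- The weight of a vertex of a visual decomposition tree. -/
noncomputable def VisualDecompTree.weight {V : Type*} {Γ : SimpleGraph V} (D : VisualDecompTree V Γ)
    (t : D.T) : ℕ := Nat.card (D.Av t)

/-- The degree of a vertex of a visual decomposition tree. -/
noncomputable def VisualDecompTree.degree {V : Type*} {Γ : SimpleGraph V} (D : VisualDecompTree V Γ)
    (t : D.T) : ℕ := Nat.card (D.tree.neighborSet t)

/-- A vertex is black if its weight strictly exceeds its degree (white otherwise). -/
def VisualDecompTree.Black {V : Type*} {Γ : SimpleGraph V} (D : VisualDecompTree V Γ)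
    (t : D.T) : Prop := D.degree t < D.weight t

/-- The visual decomposition tree as a colored graph (colored by the black/white property). -/
def VisualDecompTree.colored {V : Type*} {Γ : SimpleGraph V} (D : VisualDecompTree V Γ) :
    ColoredGraph Prop :=
  ⟨D.T, D.tree, fun t => D.Black t⟩

section WordMetric

variable {G : Type*} [Group G] {S : Set G}

lemma exists_word (hS : Subgroup.closure S = ⊤) (g : G) :
    ∃ w : List G, (∀ x ∈ w, x ∈ S ∨ x⁻¹ ∈ S) ∧ g = w.prod := by
  have hg : g ∈ Subgroup.closure S := hS ▸ Subgroup.mem_top g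
  rw [← Subgroup.mem_toSubmonoid, Subgroup.closure_toSubmonoid] at hg
  obtain ⟨w, hw, hp⟩ := Submonoid.exists_list_of_mem_closure hg
  exact ⟨w, fun x hx => by simpa using hw x hx, hp.symm⟩

lemma wordDist_le_length {g h : G} {w : List G} (hw : ∀ x ∈ w, x ∈ S ∨ x⁻¹ ∈ S)
    (hp : g⁻¹ * h = w.prod) : wordDist S g h ≤ w.length :=
  Nat.sInf_le ⟨w, rfl, hw, hp⟩

lemma exists_word_length_eq_wordDist (hS : Subgroup.closure S = ⊤) (g h : G) :
    ∃ w : List G, w.length = wordDist S g h ∧ (∀ x ∈ w, x ∈ S ∨ x⁻¹ ∈ S) ∧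
      g⁻¹ * h = w.prod := by
  obtain ⟨w, hw, hp⟩ := exists_word hS (g⁻¹ * h)
  exact Nat.sInf_mem (s := {n | ∃ w : List G, w.length = n ∧ (∀ x ∈ w, x ∈ S ∨ x⁻¹ ∈ S) ∧
    g⁻¹ * h = w.prod}) ⟨_, w, rfl, hw, hp⟩

@[simp] lemma wordDist_self (g : G) : wordDist S g g = 0 :=
  Nat.le_zero.mp (wordDist_le_length (w := []) (by simp) (by simp))

lemma wordDist_mul_left (u g h : G) : wordDist S (u * g) (u * h) = wordDist S g h := by
  simp [wordDist, mul_assoc]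

lemma wordDist_comm (hS : Subgroup.closure S = ⊤) (g h : G) :
    wordDist S g h = wordDist S h g := by
  suffices H : ∀ g h : G, wordDist S g h ≤ wordDist S h g from le_antisymm (H g h) (H h g)
  intro g h
  obtain ⟨w, hl, hw, hp⟩ := exists_word_length_eq_wordDist hS h g
  rw [← hl]
  refine (wordDist_le_length (w := (w.map (·⁻¹)).reverse) ?_ ?_).trans_eq (by simp)
  · intro x hx
    simp only [List.mem_reverse, List.mem_map] at hx
    obtain ⟨y, hy, rfl⟩ := hx
    simpa [or_comm] using hw y hy
  · rw [← List.prod_inv_reverse, ← hp]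
    simp

lemma wordDist_triangle (hS : Subgroup.closure S = ⊤) (g h k : G) :
    wordDist S g k ≤ wordDist S g h + wordDist S h k := by
  obtain ⟨w, hl, hw, hp⟩ := exists_word_length_eq_wordDist hS g h
  obtain ⟨w', hl', hw', hp'⟩ := exists_word_length_eq_wordDist hS h k
  rw [← hl, ← hl', ← List.length_append]
  refine wordDist_le_length ?_ ?_
  · intro x hx
    rcases List.mem_append.mp hx with hx | hx
    exacts [hw x hx, hw' x hx]
  · rw [List.prod_append, ← hp, ← hp']
    group

lemma finite_ball (hS : Subgroup.closure S = ⊤) (hfin : S.Finite) (n : ℕ) :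
    {g : G | wordDist S 1 g ≤ n}.Finite := by
  have hA : (S ∪ S⁻¹).Finite := hfin.union hfin.inv
  have : Finite ↑(S ∪ S⁻¹) := hA
  refine ((List.finite_length_le ↑(S ∪ S⁻¹) n).image
    fun w => (w.map (Subtype.val)).prod).subset ?_
  intro g hg
  obtain ⟨w, hl, hw, hp⟩ := exists_word_length_eq_wordDist hS 1 g
  lift w to List ↑(S ∪ S⁻¹) using hw
  refine ⟨w, ?_, ?_⟩
  · simp only [List.length_map] at hl
    simpa [hl] using hg
  · simpa using hp.symm

/-- `γ` restricted to `{0, …, n}` is a geodesic for the word metric. -/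
def IsGeodesicUpTo (S : Set G) (n : ℕ) (γ : ℕ → G) : Prop :=
  ∀ i j, i ≤ j → j ≤ n → wordDist S (γ i) (γ j) = j - i

lemma exists_geodesic (hS : Subgroup.closure S = ⊤) (x y : G) :
    ∃ γ : ℕ → G, γ 0 = x ∧ γ (wordDist S x y) = y ∧ IsGeodesicUpTo S (wordDist S x y) γ := by
  obtain ⟨w, hl, hw, hp⟩ := exists_word_length_eq_wordDist hS x y
  rw [← hl]
  have hle : ∀ i j, i ≤ j →
      wordDist S (x * (w.take i).prod) (x * (w.take j).prod) ≤ j - i := by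
    intro i j hij
    refine (wordDist_le_length (w := (w.drop i).take (j - i)) ?_ ?_).trans (by simp)
    · intro a ha
      exact hw a (List.mem_of_mem_drop (List.mem_of_mem_take ha))
    · obtain ⟨k, rfl⟩ := Nat.exists_eq_add_of_le hij
      rw [List.take_add, List.prod_append, Nat.add_sub_cancel_left]
      group
  have hend : x * (w.take w.length).prod = y := by simp [← hp]
  refine ⟨fun i => x * (w.take i).prod, by simp, hend, ?_⟩
  intro i j hij hj
  refine le_antisymm (hle i j hij) ?_
  have h1 := hle 0 i (Nat.zero_le _)
  have h2 := hle j _ hj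
  rw [hend] at h2
  simp only [List.take_zero, List.prod_nil, mul_one] at h1
  have h3 := wordDist_triangle hS x (x * (w.take i).prod) y
  have h4 := wordDist_triangle hS (x * (w.take i).prod) (x * (w.take j).prod) y
  dsimp only
  omega

lemma isQuasiGeodesic_three_of_le (hS : Subgroup.closure S = ⊤) {n : ℕ} {q : ℕ → G}
    (h : ∀ i j, i ≤ j → j ≤ n →
      wordDist S (q i) (q j) ≤ j - i ∧ j - i ≤ 3 * wordDist S (q i) (q j)) :
    IsQuasiGeodesic S 3 0 (fun i : Fin (n + 1) => q i) := by
  have key : ∀ i j : ℕ, i ≤ j → j ≤ n →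
      (wordDist S (q i) (q j) : ℝ) ≤ 3 * |(i : ℝ) - (j : ℝ)| + 0 ∧
        |(i : ℝ) - (j : ℝ)| / 3 - 0 ≤ (wordDist S (q i) (q j) : ℝ) := by
    intro i j hij hj
    obtain ⟨h1, h2⟩ := h i j hij hj
    have h1' : (wordDist S (q i) (q j) : ℝ) ≤ ((j - i : ℕ) : ℝ) := by exact_mod_cast h1
    have h2' : ((j - i : ℕ) : ℝ) ≤ 3 * (wordDist S (q i) (q j) : ℝ) := by exact_mod_cast h2
    have h0 : (i : ℝ) ≤ j := by exact_mod_cast hij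
    rw [Nat.cast_sub hij] at h1' h2'
    rw [abs_sub_comm, abs_of_nonneg (sub_nonneg.mpr h0)]
    constructor <;> linarith
  intro i j
  rcases le_total (i : ℕ) (j : ℕ) with hij | hij
  · exact key i j hij (Nat.lt_succ_iff.mp j.2)
  · have := key j i hij (Nat.lt_succ_iff.mp i.2)
    rwa [abs_sub_comm, wordDist_comm hS] at this

lemma exists_quasiGeodesic_through_midpoint (hS : Subgroup.closure S = ⊤) {N D : ℕ} {γ : ℕ → G}
    (hγ : IsGeodesicUpTo S N γ) {x y : G} (hx : wordDist S x (γ 0) ≤ D)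
    (hy : wordDist S y (γ N) ≤ D) (hD : 8 * D ≤ N) :
    ∃ (n : ℕ) (q : ℕ → G), q 0 = x ∧ q n = y ∧
      IsQuasiGeodesic S 3 0 (fun i : Fin (n + 1) => q i) ∧ ∃ i ≤ n, q i = γ (N / 2) := by
  have tri := wordDist_triangle hS
  have sym := wordDist_comm hS
  obtain ⟨z, hz, hzmin⟩ := Finset.exists_min_image (Finset.range (N + 1))
    (fun t => wordDist S x (γ t)) ⟨0, by simp⟩
  obtain ⟨w, hw, hwmin⟩ := Finset.exists_min_image (Finset.range (N + 1))
    (fun t => wordDist S y (γ t)) ⟨0, by simp⟩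
  simp only [Finset.mem_range, Nat.lt_succ_iff] at hz hzmin hw hwmin
  have hz0 := hzmin 0 (Nat.zero_le _)
  have hwN := hwmin N le_rfl
  have hzD : z ≤ 2 * D := by
    have h1 := hγ 0 z (Nat.zero_le _) hz
    have h2 := tri (γ 0) x (γ z)
    have h3 := sym (γ 0) x
    omega
  have hwD : N - w ≤ 2 * D := by
    have h1 := hγ w N hw le_rfl
    have h2 := tri (γ w) y (γ N)
    have h3 := sym (γ w) y
    omega
  obtain ⟨β, hβ0, hβ1, hβ⟩ := exists_geodesic hS x (γ z)
  obtain ⟨δ, hδ0, hδ1, hδ⟩ := exists_geodesic hS (γ w) y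
  have hc : wordDist S (γ w) y ≤ D := by rw [sym]; exact hwN.trans hy
  have ha : wordDist S x (γ z) ≤ D := hz0.trans hx
  have hwmin' : ∀ t ≤ N, wordDist S (γ w) y ≤ wordDist S (γ t) y := by
    intro t ht
    rw [sym _ y, sym _ y]
    exact hwmin t ht
  generalize wordDist S x (γ z) = a at *
  generalize wordDist S (γ w) y = c at *
  obtain ⟨m, rfl⟩ : ∃ m, w = z + m := Nat.exists_eq_add_of_le (by omega)
  let q : ℕ → G := fun i =>
    if i ≤ a then β i else if i ≤ a + m then γ (z + (i - a)) else δ (i - (a + m))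
  have q1 : ∀ i, i ≤ a → q i = β i := fun i hi => if_pos hi
  have q2 : ∀ i, i ≤ m → q (a + i) = γ (z + i) := by
    intro i hi
    rcases Nat.eq_zero_or_pos i with rfl | h0
    · simp [q, hβ1]
    · simp only [q]
      rw [if_neg (by omega), if_pos (by omega)]
      congr 1
      omega
  have q3 : ∀ i, q (a + m + i) = δ i := by
    intro i
    rcases Nat.eq_zero_or_pos i with rfl | h0
    · rw [add_zero, q2 m le_rfl, hδ0]
    · simp only [q]
      rw [if_neg (by omega), if_neg (by omega)]
      congr 1
      omega
  refine ⟨a + m + c, q, by rw [q1 0 (Nat.zero_le _), hβ0], by rw [q3, hδ1],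
    isQuasiGeodesic_three_of_le hS ?_, a + (N / 2 - z), by omega, ?_⟩
  · intro i j hij hj
    rcases le_or_gt i a with hi | hi
    · rw [q1 i hi]
      have e1 := hβ i a hi le_rfl
      have e0 := hβ 0 i (Nat.zero_le _) hi
      rw [hβ0] at e0
      rw [hβ1] at e1
      rcases le_or_gt j a with hja | hja
      · rw [q1 j hja, hβ i j hij hja]
        omega
      · rcases le_or_gt j (a + m) with hjm | hjm
        · obtain ⟨t, rfl⟩ : ∃ t, j = a + t := Nat.exists_eq_add_of_le hja.le
          rw [q2 t (by omega)]
          have e2 := hγ z (z + t) (by omega) (by omega)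
          have e3 := hzmin (z + t) (by omega)
          have e4 := tri x (β i) (γ (z + t))
          have e5 := tri (γ z) (β i) (γ (z + t))
          have e6 := tri (β i) (γ z) (γ (z + t))
          have e7 := sym (γ z) (β i)
          omega
        · obtain ⟨k, rfl⟩ : ∃ k, j = a + m + k := Nat.exists_eq_add_of_le hjm.le
          rw [q3 k]
          have e2 := hγ z (z + m) (by omega) (by omega)
          have e3 := hδ 0 k (Nat.zero_le _) (by omega)
          rw [hδ0] at e3
          have e4 := tri (γ z) (β i) (γ (z + m))
          have e5 := tri (β i) (δ k) (γ (z + m))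
          have e6 := tri (β i) (γ z) (δ k)
          have e7 := tri (γ z) (γ (z + m)) (δ k)
          have e8 := sym (γ z) (β i)
          have e9 := sym (δ k) (γ (z + m))
          omega
    · rcases le_or_gt i (a + m) with him | him
      · obtain ⟨s, rfl⟩ : ∃ s, i = a + s := Nat.exists_eq_add_of_le hi.le
        rw [q2 s (by omega)]
        rcases le_or_gt j (a + m) with hjm | hjm
        · obtain ⟨t, rfl⟩ : ∃ t, j = a + t := Nat.exists_eq_add_of_le (by omega)
          rw [q2 t (by omega), hγ (z + s) (z + t) (by omega) (by omega)]
          omega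
        · obtain ⟨k, rfl⟩ : ∃ k, j = a + m + k := Nat.exists_eq_add_of_le hjm.le
          rw [q3 k]
          have e1 := hδ k c (by omega) le_rfl
          have e0 := hδ 0 k (Nat.zero_le _) (by omega)
          rw [hδ0] at e0
          rw [hδ1] at e1
          have e2 := hγ (z + s) (z + m) (by omega) (by omega)
          have e3 := hwmin' (z + s) (by omega)
          have e4 := tri (γ (z + s)) (δ k) y
          have e5 := tri (γ (z + s)) (δ k) (γ (z + m))
          have e6 := tri (γ (z + s)) (γ (z + m)) (δ k)
          have e7 := sym (δ k) (γ (z + m))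
          omega
      · obtain ⟨s, rfl⟩ : ∃ s, i = a + m + s := Nat.exists_eq_add_of_le him.le
        obtain ⟨t, rfl⟩ : ∃ t, j = a + m + t := Nat.exists_eq_add_of_le (by omega)
        rw [q3, q3, hδ s t (by omega) (by omega)]
        omega
  · rw [q2 _ (by omega)]
    congr 1
    omega

lemma StronglyQuasiconvex.exists_midpoint_bound (hS : Subgroup.closure S = ⊤) {H : Subgroup G}
    (hH : StronglyQuasiconvex S (H : Set G)) :
    ∃ M : ℕ, ∀ (u l : G) (N : ℕ) (γ : ℕ → G), u⁻¹ * l * u ∈ H → γ 0 = 1 → γ N = l →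
      IsGeodesicUpTo S N γ → 8 * wordDist S 1 u ≤ N →
      ∃ h ∈ H, wordDist S (γ (N / 2)) (u * h) ≤ M := by
  obtain ⟨M, hM⟩ := hH 3 0 (by norm_num) le_rfl
  refine ⟨⌊M⌋₊, fun u l N γ hl h0 h1 hγ hN => ?_⟩
  have hx : wordDist S u (γ 0) ≤ wordDist S 1 u := by rw [h0, wordDist_comm hS]
  have hy : wordDist S (l * u) (γ N) ≤ wordDist S 1 u := by
    rw [h1, wordDist_comm hS]
    conv_lhs => rw [← mul_one l, mul_assoc, one_mul]
    rw [wordDist_mul_left]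
  obtain ⟨n, q, hq0, hqn, hq, i, hi, hqi⟩ :=
    exists_quasiGeodesic_through_midpoint hS hγ hx hy hN
  obtain ⟨h, hh, hd⟩ := hM n (fun i : Fin (n + 1) => u⁻¹ * q i) (by simp [hq0])
    (by simpa [hqn, mul_assoc] using hl)
    (by simpa only [IsQuasiGeodesic, wordDist_mul_left] using hq) ⟨i, Nat.lt_succ_iff.mpr hi⟩
  refine ⟨h, hh, Nat.le_floor ?_⟩
  rw [← hqi, ← wordDist_mul_left u⁻¹]
  simpa using hd

/-- A strongly quasiconvex subgroup has finite index as soon as the intersection of any finite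
family of its conjugates is infinite. -/
theorem StronglyQuasiconvex.finiteIndex (hS : Subgroup.closure S = ⊤) (hfin : S.Finite)
    {H : Subgroup G} (hH : StronglyQuasiconvex S (H : Set G))
    (hinf : ∀ F : Finset G, {l : G | ∀ u ∈ F, u⁻¹ * l * u ∈ H}.Infinite) : H.FiniteIndex := by
  classical
  obtain ⟨M, hM⟩ := hH.exists_midpoint_bound hS
  have hB := finite_ball hS hfin M
  by_contra hHi
  have : Infinite (G ⧸ H) := by
    rw [← not_finite_iff_infinite]
    intro h
    exact hHi Subgroup.finiteIndex_of_finite_quotient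
  obtain ⟨F, hF⟩ := Infinite.exists_subset_card_eq (G ⧸ H) (hB.toFinset.card + 1)
  obtain ⟨l, hl, hlN⟩ : ∃ l, (∀ u ∈ F.image Quotient.out, u⁻¹ * l * u ∈ H) ∧
      8 * (F.image Quotient.out).sup (wordDist S 1) ≤ wordDist S 1 l := by
    obtain ⟨l, hl, hl'⟩ := (hinf (F.image Quotient.out)).exists_notMem_finite
      (finite_ball hS hfin (8 * (F.image Quotient.out).sup (wordDist S 1)))
    exact ⟨l, hl, (not_le.mp hl').le⟩
  obtain ⟨γ, h0, h1, hγ⟩ := exists_geodesic hS 1 l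
  set p := γ (wordDist S 1 l / 2)
  have hsub : F ⊆ hB.toFinset.image (fun b => (QuotientGroup.mk (p * b) : G ⧸ H)) := by
    intro c hc
    have hcm : Quotient.out c ∈ F.image Quotient.out := Finset.mem_image_of_mem _ hc
    obtain ⟨h, hh, hd⟩ := hM (Quotient.out c) l _ γ (hl _ hcm) h0 h1 hγ
      ((Nat.mul_le_mul_left 8 (Finset.le_sup hcm)).trans hlN)
    refine Finset.mem_image.mpr ⟨p⁻¹ * (Quotient.out c * h), ?_, ?_⟩
    · rw [Set.Finite.mem_toFinset, Set.mem_ofPred_eq, ← wordDist_mul_left p]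
      simpa using hd
    · rw [mul_inv_cancel_left, QuotientGroup.mk_mul_of_mem _ hh]
      exact Quotient.out_eq c
  have h2 := (Finset.card_le_card hsub).trans Finset.card_image_le
  omega

/-- The trace of a strongly quasiconvex subgroup on an undistorted subgroup is strongly
quasiconvex there. -/
theorem StronglyQuasiconvex.subgroupOf (hS : Subgroup.closure S = ⊤) (hfin : S.Finite)
    {H A : Subgroup G} (hH : StronglyQuasiconvex S (H : Set G)) {T : Set A}
    (hA : Undistorted S A T) : StronglyQuasiconvex T (H.subgroupOf A : Set A) := by
  intro K C hK hC
  obtain ⟨K₀, C₀, hK₀, hC₀, hd⟩ := hA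
  obtain ⟨M, hM⟩ := hH (K₀ * K) (K₀ * C + C₀ + C) (by nlinarith) (by positivity)
  have hb : ∀ b : G, ∃ R : ℕ, ∀ a : A, (a : G) * b ∈ H →
      ∃ k ∈ H.subgroupOf A, wordDist T a k ≤ R := by
    intro b
    by_cases hex : ∃ a₀ : A, (a₀ : G) * b ∈ H
    · obtain ⟨a₀, ha₀⟩ := hex
      refine ⟨wordDist T 1 a₀⁻¹, fun a ha => ⟨a * a₀⁻¹, ?_, ?_⟩⟩
      · rw [Subgroup.mem_subgroupOf]
        have := H.mul_mem ha (H.inv_mem ha₀)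
        simpa [mul_assoc] using this
      · conv_lhs => rw [← mul_one a, mul_assoc, one_mul]
        rw [wordDist_mul_left]
    · exact ⟨0, fun a ha => (hex ⟨a, ha⟩).elim⟩
  choose R hR using hb
  obtain ⟨B, hB⟩ := ((finite_ball hS hfin ⌊M⌋₊).image R).bddAbove
  refine ⟨B, fun n q h0 hn hq i => ?_⟩
  obtain ⟨h, hh, hdh⟩ := hM n (fun i => (q i : G)) h0 hn (by
    intro i j
    obtain ⟨h1, h2⟩ := hq i j
    obtain ⟨h3, h4⟩ := hd (q i) (q j)
    set t := |((i : ℕ) : ℝ) - ((j : ℕ) : ℝ)|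
    have ht : 0 ≤ t := abs_nonneg _
    have hK0 : 0 < K := by linarith
    have hK₀0 : 0 < K₀ := by linarith
    constructor
    · have := mul_le_mul_of_nonneg_left h1 hK₀0.le
      nlinarith
    · have h5 : t / K ≤ K₀ * (wordDist S (q i : G) (q j : G)) + C₀ + C := by linarith
      have h6 : t / K ≤ K₀ * (wordDist S (q i : G) (q j : G) + (K₀ * C + C₀ + C)) := by
        have h7 : C₀ ≤ K₀ * C₀ := by nlinarith
        have h8 : C ≤ K₀ * C := by nlinarith
        have h9 : 0 ≤ K₀ * (K₀ * C) := by positivity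
        nlinarith
      rw [mul_comm K₀ K, ← div_div, sub_le_iff_le_add, div_le_iff₀ hK₀0]
      linarith) i
  obtain ⟨k, hk, hkd⟩ := hR ((q i : G)⁻¹ * h) (q i) (by simpa using hh)
  refine ⟨k, hk, ?_⟩
  have hmem : wordDist S 1 ((q i : G)⁻¹ * h) ≤ ⌊M⌋₊ := by
    rw [← wordDist_mul_left (q i : G)]
    simpa using Nat.le_floor hdh
  exact_mod_cast hkd.trans (hB ⟨_, hmem, rfl⟩)

end WordMetric

section FreeActionOnTree

variable {V X : Type*} {T : SimpleGraph V} [Group X]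

/-- The product of the labels `c` along a walk; labels of later edges are multiplied on the
left. -/
def walkLabel (c : V → V → X) : ∀ {u v : V}, T.Walk u v → X
  | _, _, .nil => 1
  | u, _, .cons (v := v) _ p => walkLabel c p * c u v

lemma walkLabel_append (c : V → V → X) {u v w : V} (p : T.Walk u v) (q : T.Walk v w) :
    walkLabel c (p.append q) = walkLabel c q * walkLabel c p := by
  induction p with
  | nil => simp [walkLabel]
  | cons h p ih => simp [walkLabel, ih, mul_assoc]

/-- On a tree every labelling of the edges is the coboundary of a labelling of the vertices. -/
lemma exists_potential (hT : T.IsTree) (c : V → V → X)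
    (hc : ∀ v w, T.Adj v w → c w v = (c v w)⁻¹) :
    ∃ ψ : V → X, ∀ v w, T.Adj v w → ψ w = c v w * ψ v := by
  classical
  obtain ⟨v₀⟩ := hT.connected.nonempty
  choose p hp hu using fun v => hT.existsUnique_path v₀ v
  refine ⟨fun v => walkLabel c (p v), fun v w hvw => ?_⟩
  by_cases hw : w ∈ (p v).support
  · have h1 : (p v).takeUntil w hw = p w := hu w _ ((hp v).takeUntil hw)
    have h2 : (p v).dropUntil w hw = .cons hvw.symm .nil :=
      (hT.existsUnique_path w v).unique ((hp v).dropUntil hw) (by simp [hvw.ne'])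
    have h3 := congrArg (walkLabel c) ((p v).take_spec hw)
    rw [walkLabel_append, h1, h2] at h3
    dsimp only
    rw [← h3]
    simp [walkLabel, hc v w hvw]
  · have h1 : (p v).append (.cons hvw .nil) = p w := hu w _ ((hp v).concat hw hvw)
    dsimp only
    rw [← h1, walkLabel_append]
    simp [walkLabel]

/-- Two functions on a connected graph with equal increments along edges have equal
increments between any two vertices. -/
lemma increment_eq (hT : T.Connected) {ψ φ : V → X}
    (h : ∀ v w, T.Adj v w → ψ w * (ψ v)⁻¹ = φ w * (φ v)⁻¹) (v w : V) :
    ψ w * (ψ v)⁻¹ = φ w * (φ v)⁻¹ := by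
  obtain ⟨p⟩ := hT.preconnected v w
  induction p with
  | nil => simp
  | @cons u v w huv p ih =>
    have := congrArg₂ (· * ·) ih (h u v huv)
    simpa [mul_assoc] using this

end FreeActionOnTree

section OrbitGroupoid

open CategoryTheory

/-- The objects of the groupoid of `G`-orbits of pairs of points of `V`, trivialised by the choice
of a representative of each orbit. -/
structure OrbitGroupoid (G V : Type) [Group G] [MulAction G V] where
  /-- The underlying orbit. -/
  orbit : MulAction.orbitRel.Quotient G V

variable {G V : Type} [Group G] [MulAction G V]

/-- A morphism `g` from `a` to `b` stands for the orbit of the pair `(a.rep, g • b.rep)`. -/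
instance : Groupoid (OrbitGroupoid G V) where
  Hom _ _ := G
  id _ := 1
  comp g h := g * h
  inv g := g⁻¹
  id_comp := one_mul
  comp_id := mul_one
  assoc := mul_assoc
  inv_comp := inv_mul_cancel
  comp_inv := mul_inv_cancel

namespace OrbitGroupoid

/-- The element `g` viewed as a morphism from `a` to `b`. -/
def hom (a b : OrbitGroupoid G V) (g : G) : a ⟶ b := g

lemma hom_comp_hom (a b c : OrbitGroupoid G V) (g h : G) :
    hom a b g ≫ hom b c h = hom a c (g * h) := rfl

/-- The vertex groups of the orbit groupoid are isomorphic to the acting group. -/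
def endMulEquiv (a : OrbitGroupoid G V) : End a ≃* G where
  toFun g := (show G from g)⁻¹
  invFun g := hom a a g⁻¹
  left_inv g := inv_inv (show G from g)
  right_inv g := inv_inv g
  map_mul' g h := mul_inv_rev (show G from h) (show G from g)

/-- The chosen representative of an orbit. -/
noncomputable def rep (a : OrbitGroupoid G V) : V := Quotient.out a.orbit

/-- The orbit of a point. -/
def of (v : V) : OrbitGroupoid G V := ⟨Quotient.mk (MulAction.orbitRel G V) v⟩

lemma exists_smul_rep_of (v : V) : ∃ g : G, g • (of v : OrbitGroupoid G V).rep = v := by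
  have : MulAction.orbitRel G V v (of v : OrbitGroupoid G V).rep :=
    (MulAction.orbitRel G V).symm (Quotient.mk_out v)
  exact this

/-- An element carrying the representative of the orbit of `v` to `v`. -/
noncomputable def trans (G : Type) {V : Type} [Group G] [MulAction G V] (v : V) : G :=
  (exists_smul_rep_of v).choose

lemma trans_smul_rep (v : V) : trans G v • (of v : OrbitGroupoid G V).rep = v :=
  (exists_smul_rep_of v).choose_spec

lemma of_smul (g : G) (v : V) : (of (g • v) : OrbitGroupoid G V) = of v :=
  congrArg mk (Quotient.sound ⟨g, rfl⟩)

@[simp] lemma of_rep (a : OrbitGroupoid G V) : of a.rep = a :=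
  congrArg mk (Quotient.out_eq a.orbit)

lemma trans_smul (hfree : ∀ (g : G) (v : V), g • v = v → g = 1) (g : G) (v : V) :
    trans G (g • v) = g * trans G v := by
  have h := trans_smul_rep (G := G) (g • v)
  rw [of_smul] at h
  conv_rhs at h => rw [← trans_smul_rep (G := G) v]
  rw [← inv_mul_eq_one]
  refine hfree _ (of v : OrbitGroupoid G V).rep ?_
  rw [mul_smul, inv_smul_eq_iff, mul_smul, h]

lemma trans_rep (hfree : ∀ (g : G) (v : V), g • v = v → g = 1) (a : OrbitGroupoid G V) :
    trans G a.rep = 1 := by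
  have h := trans_smul_rep (G := G) a.rep
  rw [of_rep] at h
  exact hfree _ _ h

instance [Nonempty V] : IsConnected (OrbitGroupoid G V) := by
  have : Nonempty (OrbitGroupoid G V) := (‹Nonempty V›).map of
  exact zigzag_isConnected fun a b => Zigzag.of_hom (hom a b 1)

end OrbitGroupoid

/-- A group acting without inversions preserves some orientation of the edges. -/
lemma exists_invariant_orientation {T : SimpleGraph V}
    (hninv : ∀ (g : G) (v w : V), T.Adj v w → ¬ (g • v = w ∧ g • w = v)) :
    ∃ O : V → V → Prop, (∀ (g : G) v w, O (g • v) (g • w) ↔ O v w) ∧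
      ∀ v w, T.Adj v w → (O w v ↔ ¬ O v w) := by
  let π : V × V → MulAction.orbitRel.Quotient G (V × V) := Quotient.mk _
  let _ : LinearOrder (MulAction.orbitRel.Quotient G (V × V)) :=
    WellOrderingRel.isWellOrder.linearOrder
  refine ⟨fun v w => π (v, w) < π (w, v), fun g v w => ?_, fun v w hvw => ?_⟩
  · have h : ∀ v w, π (g • v, g • w) = π (v, w) := fun v w => Quotient.sound ⟨g, rfl⟩
    dsimp only
    rw [h, h]
  · have hne : π (v, w) ≠ π (w, v) := by
      intro h
      obtain ⟨g, hg⟩ : MulAction.orbitRel G (V × V) (v, w) (w, v) := Quotient.exact h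
      simp only [Prod.smul_mk, Prod.mk.injEq] at hg
      exact hninv g v w hvw ⟨hg.2, hg.1⟩
    rw [not_lt]
    exact ⟨le_of_lt, fun h => lt_of_le_of_ne h hne.symm⟩

namespace OrbitGroupoid

/-- The orbit groupoid of a free action without inversions on a tree is free on the set of
orbits of positively oriented edges. -/
lemma nonempty_isFreeGroupoid {T : SimpleGraph V} (hT : T.IsTree) (hact : ActsOnGraph G T)
    (hninv : ∀ (g : G) (v w : V), T.Adj v w → ¬ (g • v = w ∧ g • w = v))
    (hfree : ∀ (g : G) (v : V), g • v = v → g = 1) :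
    Nonempty (IsFreeGroupoid (OrbitGroupoid G V)) := by
  classical
  obtain ⟨O, hO, hOadj⟩ := exists_invariant_orientation hninv
  have hadj : ∀ (g : G) v w, T.Adj (g • v) (g • w) ↔ T.Adj v w := fun g v w =>
    ⟨fun h => by simpa using hact g⁻¹ _ _ h, hact g v w⟩
  have hback : ∀ v w : V, (trans G v)⁻¹ • v = (of v : OrbitGroupoid G V).rep ∧
      (trans G v)⁻¹ • w = ((trans G v)⁻¹ * trans G w) • (of w : OrbitGroupoid G V).rep := by
    intro v w
    rw [mul_smul, trans_smul_rep, inv_smul_eq_iff, trans_smul_rep]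
    exact ⟨rfl, rfl⟩
  refine ⟨{
    quiverGenerators := ⟨fun a b => {g : G // T.Adj (rep a) (g • rep b) ∧ O (rep a) (g • rep b)}⟩
    of := fun {a b} e => hom a b e.1
    unique_lift := ?_ }⟩
  intro X _ f
  -- the label of an edge orbit, extended by `1` to all morphisms
  let f' : ∀ (a b : OrbitGroupoid G V), G → X := fun a b g =>
    if h : T.Adj a.rep (g • b.rep) ∧ O a.rep (g • b.rep) then
      f (a := (a : IsFreeGroupoid.Generators (OrbitGroupoid G V)))
        (b := (b : IsFreeGroupoid.Generators (OrbitGroupoid G V))) ⟨g, h⟩ else 1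
  let e : V → V → X := fun v w => f' (of v) (of w) ((trans G v)⁻¹ * trans G w)
  let c : V → V → X := fun v w => if O v w then e v w else (e w v)⁻¹
  have hc : ∀ v w, T.Adj v w → c w v = (c v w)⁻¹ := by
    intro v w hvw
    have := hOadj v w hvw
    by_cases h : O v w <;> simp [c, h, this]
  have he_smul : ∀ (g : G) v w, e (g • v) (g • w) = e v w := by
    intro g v w
    simp only [e, trans_smul hfree, of_smul, mul_inv_rev, mul_assoc, inv_mul_cancel_left]
  have hc_smul : ∀ (g : G) v w, c (g • v) (g • w) = c v w := by
    intro g v w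
    simp only [c, hO, he_smul]
  obtain ⟨ψ, hψ⟩ := exists_potential hT c hc
  have hψ_smul : ∀ (g : G) v w, ψ (g • w) * (ψ (g • v))⁻¹ = ψ w * (ψ v)⁻¹ := by
    intro g
    refine increment_eq hT.connected (ψ := fun v => ψ (g • v)) fun v w hvw => ?_
    rw [hψ _ _ hvw, hψ _ _ (hact g v w hvw), hc_smul]
    simp
  have he_rep : ∀ (a b : OrbitGroupoid G V) (g : G), e a.rep (g • b.rep) = f' a b g := by
    intro a b g
    simp only [e, of_smul, trans_smul hfree, trans_rep hfree, of_rep, inv_one, one_mul, mul_one]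
  let F : OrbitGroupoid G V ⥤ SingleObj X :=
    { obj := fun _ => SingleObj.star X
      map := fun {a b} g => ψ ((show G from g) • b.rep) * (ψ a.rep)⁻¹
      map_id := fun a => by
        change ψ ((1 : G) • a.rep) * (ψ a.rep)⁻¹ = 1
        simp
      map_comp := fun {a b d} g h => by
        change ψ (((show G from g) * (show G from h)) • d.rep) * (ψ a.rep)⁻¹ =
          (ψ ((show G from h) • d.rep) * (ψ b.rep)⁻¹) *
            (ψ ((show G from g) • b.rep) * (ψ a.rep)⁻¹)
        rw [← hψ_smul (show G from g) b.rep, mul_smul]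
        simp [mul_assoc] }
  refine ⟨F, ?_, ?_⟩
  · have hF : ∀ (a b : OrbitGroupoid G V) (g : G), T.Adj a.rep (g • b.rep) →
        O a.rep (g • b.rep) → F.map (hom a b g) = f' a b g := by
      intro a b g h1 h2
      change ψ (g • b.rep) * (ψ a.rep)⁻¹ = _
      rw [hψ _ _ h1, mul_inv_cancel_right]
      simp only [c, if_pos h2]
      exact he_rep a b g
    exact fun a b x => (hF a b x.1 x.2.1 x.2.2).trans (dif_pos x.2)
  · intro E hE
    have hE' : ∀ (a b : OrbitGroupoid G V) (g : G), T.Adj a.rep (g • b.rep) →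
        O a.rep (g • b.rep) → E.map (hom a b g) = f' a b g := by
      intro a b g h1 h2
      let x : {g : G // T.Adj a.rep (g • b.rep) ∧ O a.rep (g • b.rep)} := ⟨g, h1, h2⟩
      have h3 : f' a b g = f (a := (a : IsFreeGroupoid.Generators (OrbitGroupoid G V)))
        (b := (b : IsFreeGroupoid.Generators (OrbitGroupoid G V))) x := dif_pos x.2
      exact (hE a b x).trans h3.symm
    obtain ⟨v₀⟩ := hT.connected.nonempty
    have hE_comp : ∀ (a b d : OrbitGroupoid G V) (g h : G), (E.map (hom a d (g * h)) : X) =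
        (E.map (hom b d h) : X) * (E.map (hom a b g) : X) := by
      intro a b d g h
      rw [← hom_comp_hom a b d, E.map_comp]
      rfl
    let φ : V → X := fun v => E.map (hom (of v₀) (of v) (trans G v))
    have hφ : ∀ v w, φ w * (φ v)⁻¹ = E.map (hom (of v) (of w) ((trans G v)⁻¹ * trans G w)) := by
      intro v w
      rw [mul_inv_eq_iff_eq_mul]
      simp only [φ]
      rw [← hE_comp, mul_inv_cancel_left]
    have hpos : ∀ v w, T.Adj v w → O v w → φ w * (φ v)⁻¹ = e v w := by
      intro v w hvw hOvw
      rw [hφ]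
      rw [← hadj (trans G v)⁻¹, (hback v w).1, (hback v w).2] at hvw
      rw [← hO (trans G v)⁻¹, (hback v w).1, (hback v w).2] at hOvw
      exact hE' _ _ _ hvw hOvw
    have hinc := increment_eq hT.connected (ψ := φ) (φ := ψ) (fun v w hvw => by
      rw [hψ _ _ hvw, mul_inv_cancel_right]
      by_cases h : O v w
      · simp only [c, if_pos h]
        exact hpos v w hvw h
      · simp only [c, if_neg h]
        rw [← hpos w v hvw.symm ((hOadj v w hvw).mpr h)]
        simp)
    refine CategoryTheory.Functor.ext (fun _ => rfl) fun a b g => ?_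
    have h1 := (hinc a.rep ((show G from g) • b.rep)).symm
    rw [hφ, trans_smul hfree, trans_rep hfree, trans_rep hfree, of_smul, of_rep, of_rep] at h1
    simp only [inv_one, one_mul, mul_one] at h1
    simp only [eqToHom_refl, Category.id_comp, Category.comp_id]
    exact h1.symm

end OrbitGroupoid

/-- A group acting freely and without inversions on a tree is free. -/
theorem isFreeGroup_of_free_action_on_tree {T : SimpleGraph V} (hT : T.IsTree)
    (hact : ActsOnGraph G T)
    (hninv : ∀ (g : G) (v w : V), T.Adj v w → ¬ (g • v = w ∧ g • w = v))
    (hfree : ∀ (g : G) (v : V), g • v = v → g = 1) : IsFreeGroup G := by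
  have := hT.connected.nonempty
  obtain ⟨_⟩ := OrbitGroupoid.nonempty_isFreeGroupoid hT hact hninv hfree
  exact IsFreeGroup.ofMulEquiv (OrbitGroupoid.endMulEquiv 
    (OrbitGroupoid.of (Classical.arbitrary V) : OrbitGroupoid G V))

end OrbitGroupoid

section VertexStabilizers

variable {G V : Type*} [Group G] [MulAction G V] {T : SimpleGraph V} {H : Subgroup G}

lemma infinite_inf_of_relIndex_ne_zero {H K : Subgroup G} (h : H.relIndex K ≠ 0)
    (hK : (K : Set G).Infinite) : ((H ⊓ K : Subgroup G) : Set G).Infinite := by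
  have h1 : Infinite K := hK.to_subtype
  have h2 : (H.subgroupOf K).FiniteIndex := ⟨h⟩
  have h3 : Infinite (H.subgroupOf K) := by
    rw [← not_finite_iff_infinite] at h1 ⊢
    refine fun hf => h1 (Nat.finite_of_card_ne_zero ?_)
    rw [← (H.subgroupOf K).card_mul_index]
    exact mul_ne_zero Nat.card_pos.ne' h2.index_ne_zero
  have h4 := (Set.infinite_coe_iff.mp h3).image (Subtype.val_injective.injOn)
  refine h4.mono ?_
  rintro _ ⟨x, hx, rfl⟩
  exact ⟨hx, x.2⟩

/-- If edge stabilizers are infinite and every infinite trace of `H` on a vertex stabilizer has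
finite index there, then one infinite trace forces all traces to be of finite index. -/
lemma relIndex_stabilizer_ne_zero (hT : T.Connected)
    (hedge : ∀ v w : V, T.Adj v w →
      ((MulAction.stabilizer G v ⊓ MulAction.stabilizer G w : Subgroup G) : Set G).Infinite)
    (hH : ∀ v : V, ((H ⊓ MulAction.stabilizer G v : Subgroup G) : Set G).Infinite →
      H.relIndex (MulAction.stabilizer G v) ≠ 0)
    {v : V} (hv : ((H ⊓ MulAction.stabilizer G v : Subgroup G) : Set G).Infinite) (w : V) :
    H.relIndex (MulAction.stabilizer G w) ≠ 0 := by
  refine hH w ?_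
  obtain ⟨p⟩ := hT.preconnected v w
  induction p with
  | nil => exact hv
  | @cons u v w huv p ih =>
    refine ih ?_
    have h1 : H.relIndex (MulAction.stabilizer G u ⊓ MulAction.stabilizer G v) ≠ 0 :=
      mt (Subgroup.relIndex_eq_zero_of_le_right inf_le_left) (hH u hv)
    exact (infinite_inf_of_relIndex_ne_zero h1 (hedge u v huv)).mono
      fun x hx => ⟨hx.1, hx.2.2⟩

/-- If every vertex stabilizer has a finite index subgroup inside `H`, then any finite family of
conjugates of `H` has infinite intersection, provided some vertex stabilizer is infinite. -/
lemma infinite_forall_conj_mem (v : V) (hv : (MulAction.stabilizer G v : Set G).Infinite)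
    (hH : ∀ w : V, H.relIndex (MulAction.stabilizer G w) ≠ 0) (F : Finset G) :
    {l : G | ∀ u ∈ F, u⁻¹ * l * u ∈ H}.Infinite := by
  have h1 : (⨅ u : F, H.comap (MulAut.conj (u : G)⁻¹).toMonoidHom).relIndex
      (MulAction.stabilizer G v) ≠ 0 := by
    refine Subgroup.relIndex_iInf_ne_zero fun u => ?_
    rw [Subgroup.relIndex_comap, ← MulAction.stabilizer_smul_eq_stabilizer_map_conj]
    exact hH _
  refine (infinite_inf_of_relIndex_ne_zero h1 hv).mono ?_
  rintro l ⟨hl, -⟩ u hu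
  have := Subgroup.mem_iInf.mp hl ⟨u, hu⟩
  simpa [Subgroup.mem_comap] using this

end VertexStabilizers

/-- Proposition `vuiqua`: `G` decomposes as a finite graph of groups (encoded by
its action on the Bass–Serre tree `T`, acting without inversions and with finitely many
orbits) in which each vertex group is finitely generated, undistorted, with all strongly
quasiconvex infinite subgroups of finite index, and each edge group is infinite. Then every
strongly quasiconvex, torsion-free subgroup `H` of infinite index is free. -/
theorem stmt_5 {G V : Type} [Group G] [MulAction G V] (S : Finset G)
    (hS : Subgroup.closure (S : Set G) = ⊤)
    (T : SimpleGraph V) (hT : T.IsTree) (hact : ActsOnGraph G T)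
    (hninv : ∀ (g : G) (v w : V), T.Adj v w → ¬ (g • v = w ∧ g • w = v))
    (hfin : Finite (Quotient (MulAction.orbitRel G V)))
    (hvert : ∀ v : V, ∃ Sv : Finset (MulAction.stabilizer G v),
      Subgroup.closure (Sv : Set (MulAction.stabilizer G v)) = ⊤ ∧
      Undistorted (S : Set G) (MulAction.stabilizer G v)
        (Sv : Set (MulAction.stabilizer G v)) ∧
      ∀ K : Subgroup (MulAction.stabilizer G v),
        StronglyQuasiconvex (Sv : Set (MulAction.stabilizer G v))
          (K : Set (MulAction.stabilizer G v)) →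
        (K : Set (MulAction.stabilizer G v)).Infinite → K.FiniteIndex)
    (hedge : ∀ v w : V, T.Adj v w →
      ((MulAction.stabilizer G v ⊓ MulAction.stabilizer G w : Subgroup G) : Set G).Infinite)
    (H : Subgroup G)
    (hsqc : StronglyQuasiconvex (S : Set G) (H : Set G))
    (htf : ∀ h : G, h ∈ H → ∀ n : ℕ, 0 < n → h ^ n = 1 → h = 1)
    (hHi : ¬ H.FiniteIndex) :
    IsFreeGroup H := by
  have hSfin : (S : Set G).Finite := S.finite_toSet
  have hrel : ∀ v : V, ((H ⊓ MulAction.stabilizer G v : Subgroup G) : Set G).Infinite →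
      H.relIndex (MulAction.stabilizer G v) ≠ 0 := by
    intro v hinf
    obtain ⟨Sv, -, hund, hfi⟩ := hvert v
    refine (hfi _ (hsqc.subgroupOf hS hSfin hund) ?_).index_ne_zero
    refine Set.Infinite.of_image Subtype.val (hinf.mono ?_)
    exact fun x hx => ⟨⟨x, hx.2⟩, hx.1, rfl⟩
  have hfinite : ∀ v : V, ((H ⊓ MulAction.stabilizer G v : Subgroup G) : Set G).Finite := by
    intro v
    by_contra hinf
    exact hHi (hsqc.finiteIndex hS hSfin (infinite_forall_conj_mem v
      (Set.Infinite.mono (fun x hx => hx.2) hinf)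
      (relIndex_stabilizer_ne_zero hT.connected hedge hrel hinf)))
  refine isFreeGroup_of_free_action_on_tree (G := H) hT (fun h => hact h)
    (fun h => hninv h) fun h v hv => ?_
  have : Finite (H ⊓ MulAction.stabilizer G v : Subgroup G) := hfinite v
  obtain ⟨n, hn, hpow⟩ := isOfFinOrder_iff_pow_eq_one.mp (isOfFinOrder_of_finite
    (⟨h, h.2, hv⟩ : (H ⊓ MulAction.stabilizer G v : Subgroup G)))
  exact Subtype.ext (htf h h.2 n hn (congrArg Subtype.val hpow))

end Paper
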